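/- Let {X_n}_{n≥2} be the three-state Markov chain on {1,0,-1} with transition matrix rows (1/2,1/4,1/4), (1/3,1/3,1/3), (1/8,1/8,3/4) and initial distribution concentrated at state 0 (i.e., (0,1,0)). Let S_n = X_2+···+X_n, and for positive integers A,B let τ = inf{k : S_k = A or S_k = -B} and α = P(S_τ = A). Then α = ((18/13)·(13/10)^B - 1)/((20/13)·(13/10)^{A+B} - 1). -/

import Mathlib

open MeasureTheory ProbabilityTheory Set

noncomputable section

variable {Ω : Type*} [MeasurableSpace Ω]

/-- The σ-algebra `σ(X_2, …, X_n)` generated by the steps of a process starting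
at time 2. -/
def sigmaFrom2 (X : ℕ → Ω → ℝ) (n : ℕ) : MeasurableSpace Ω :=
  ⨆ i ∈ Finset.Icc 2 n, MeasurableSpace.comap (X i) inferInstance

/-- The transition kernel of the example chain on `{1, 0, -1}` with transition
matrix rows `(1/2, 1/4, 1/4)`, `(1/3, 1/3, 1/3)`, `(1/8, 1/8, 3/4)` (rows indexed
by current state `1, 0, -1`). -/
def exampleKernel (i j : ℝ) : ℝ :=
  if i = 1 then (if j = 1 then 1 / 2 else if j = 0 then 1 / 4 else 1 / 4)
  else if i = 0 then (if j = 1 then 1 / 3 else if j = 0 then 1 / 3 else 1 / 3)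
  else (if j = 1 then 1 / 8 else if j = 0 then 1 / 8 else 3 / 4)

/-- The Markov-chain hypotheses of the example, bundled: measurability, the state space
`{1, 0, -1}` and the Markov property with transition matrix `exampleKernel`. -/
structure IsExampleChain (μ : Measure Ω) (X : ℕ → Ω → ℝ) : Prop where
  meas : ∀ i, 2 ≤ i → Measurable (X i)
  val : ∀ n, 2 ≤ n → ∀ ω, X n ω = 1 ∨ X n ω = 0 ∨ X n ω = -1
  markov : ∀ n, 2 ≤ n → ∀ i ∈ ({1, 0, -1} : Set ℝ), ∀ j ∈ ({1, 0, -1} : Set ℝ),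
    ∀ E : Set Ω, MeasurableSet[sigmaFrom2 X n] E →
      μ (E ∩ {ω | X n ω = i ∧ X (n + 1) ω = j})
        = ENNReal.ofReal (exampleKernel i j) * μ (E ∩ {ω | X n ω = i})

/-- The random walk `X_2 + ⋯ + X_n`. -/
def walk (X : ℕ → Ω → ℝ) (n : ℕ) (ω : Ω) : ℝ := ∑ i ∈ Finset.Icc 2 n, X i ω

/-- The event that the walk visits neither `A` nor `-B` up to time `n`. -/
def survival (X : ℕ → Ω → ℝ) (A B : ℕ) (n : ℕ) : Set Ω :=
  {ω | ∀ k ≤ n, walk X k ω ≠ (A : ℝ) ∧ walk X k ω ≠ -(B : ℝ)}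

/-- The event that the walk leaves the survival event at time `n + 1` through the level `c`. -/
def exitAt (X : ℕ → Ω → ℝ) (A B : ℕ) (c : ℝ) (n : ℕ) : Set Ω :=
  survival X A B n ∩ {ω | walk X (n + 1) ω = c}

lemma exampleKernel_nonneg (i j : ℝ) : 0 ≤ exampleKernel i j := by
  unfold exampleKernel; split_ifs <;> norm_num

lemma exampleKernel_le_one (i j : ℝ) : exampleKernel i j ≤ 1 := by
  unfold exampleKernel; split_ifs <;> norm_num

lemma measurable_exampleKernel (j : ℝ) : Measurable fun i => exampleKernel i j := by
  unfold exampleKernel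
  exact Measurable.ite (measurableSet_singleton _) measurable_const
    (Measurable.ite (measurableSet_singleton _) measurable_const measurable_const)

omit [MeasurableSpace Ω] in
lemma measurable_step_sigmaFrom2 (X : ℕ → Ω → ℝ) {i n : ℕ} (hi : 2 ≤ i) (hin : i ≤ n) :
    Measurable[sigmaFrom2 X n] (X i) := by
  have h : MeasurableSpace.comap (X i) inferInstance ≤ sigmaFrom2 X n :=
    le_iSup₂_of_le i (Finset.mem_Icc.2 ⟨hi, hin⟩) le_rfl
  exact (comap_measurable (X i)).mono h le_rfl

omit [MeasurableSpace Ω] in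
lemma measurable_walk_sigmaFrom2 (X : ℕ → Ω → ℝ) {k n : ℕ} (hkn : k ≤ n) :
    Measurable[sigmaFrom2 X n] (walk X k) := by
  unfold walk
  refine Finset.measurable_fun_sum _ fun i hi => ?_
  rw [Finset.mem_Icc] at hi
  exact measurable_step_sigmaFrom2 X hi.1 (hi.2.trans hkn)

omit [MeasurableSpace Ω] in
lemma measurableSet_survival_sigmaFrom2 (X : ℕ → Ω → ℝ) (A B n : ℕ) :
    MeasurableSet[sigmaFrom2 X n] (survival X A B n) := by
  have : survival X A B n
      = ⋂ k ∈ Finset.range (n + 1), walk X k ⁻¹' ({(A : ℝ)}ᶜ ∩ {-(B : ℝ)}ᶜ) := by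
    ext ω
    simp [survival]
  rw [this]
  refine Finset.measurableSet_biInter _ fun k hk => ?_
  have hk' : k ≤ n := by simpa [Nat.lt_succ_iff] using hk
  exact measurable_walk_sigmaFrom2 X hk'
    ((measurableSet_singleton _).compl.inter (measurableSet_singleton _).compl)

omit [MeasurableSpace Ω] in
lemma walk_succ (X : ℕ → Ω → ℝ) {n : ℕ} (hn : 1 ≤ n) (ω : Ω) :
    walk X (n + 1) ω = walk X n ω + X (n + 1) ω := by
  unfold walk
  rw [Finset.sum_Icc_succ_top (by lia)]

omit [MeasurableSpace Ω] in
lemma walk_of_le_one (X : ℕ → Ω → ℝ) {n : ℕ} (hn : n ≤ 1) (ω : Ω) : walk X n ω = 0 := by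
  unfold walk
  rw [Finset.Icc_eq_empty (by lia), Finset.sum_empty]

omit [MeasurableSpace Ω] in
lemma walk_two (X : ℕ → Ω → ℝ) (ω : Ω) : walk X 2 ω = X 2 ω := by
  simp [walk]

namespace IsExampleChain

variable {μ : Measure Ω} {X : ℕ → Ω → ℝ}

lemma sigmaFrom2_le (h : IsExampleChain μ X) (n : ℕ) : sigmaFrom2 X n ≤ ‹MeasurableSpace Ω› :=
  iSup₂_le fun i hi => (h.meas i (Finset.mem_Icc.1 hi).1).comap_le

lemma measurable_walk (h : IsExampleChain μ X) (n : ℕ) : Measurable (walk X n) :=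
  (measurable_walk_sigmaFrom2 X le_rfl).mono (h.sigmaFrom2_le n) le_rfl

lemma measurableSet_survival (h : IsExampleChain μ X) (A B n : ℕ) :
    MeasurableSet (survival X A B n) :=
  h.sigmaFrom2_le n _ (measurableSet_survival_sigmaFrom2 X A B n)

lemma measurableSet_exitAt (h : IsExampleChain μ X) (A B : ℕ) (c : ℝ) (n : ℕ) :
    MeasurableSet (exitAt X A B c n) :=
  (h.measurableSet_survival A B n).inter (h.measurable_walk (n + 1) (measurableSet_singleton c))

lemma exists_int_walk (h : IsExampleChain μ X) (n : ℕ) (ω : Ω) : ∃ z : ℤ, walk X n ω = z := by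
  induction n with
  | zero => exact ⟨0, by simp [walk_of_le_one]⟩
  | succ n ih =>
    rcases Nat.eq_zero_or_pos n with rfl | hn
    · exact ⟨0, by simp [walk_of_le_one]⟩
    obtain ⟨z, hz⟩ := ih
    rw [walk_succ X hn, hz]
    rcases h.val (n + 1) (by lia) ω with hx | hx | hx <;> rw [hx]
    · exact ⟨z + 1, by push_cast; ring⟩
    · exact ⟨z, by ring⟩
    · exact ⟨z - 1, by push_cast; ring⟩

/-- While surviving, the walk stays strictly between the two levels. -/
lemma walk_mem_Ioo (h : IsExampleChain μ X) {A B : ℕ} (hA : 0 < A) (hB : 0 < B) {n : ℕ} {ω : Ω}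
    (hω : ω ∈ survival X A B n) : walk X n ω ∈ Ioo (-(B : ℝ)) A := by
  have h0 : (0 : ℝ) ∈ Ioo (-(B : ℝ)) A := by simp [hA, hB]
  induction n with
  | zero => rwa [walk_of_le_one X zero_le_one]
  | succ n ih =>
    rcases Nat.eq_zero_or_pos n with rfl | hn
    · rwa [walk_of_le_one X le_rfl]
    have ih := ih fun k hk => hω k (hk.trans n.le_succ)
    obtain ⟨hneA, hneB⟩ := hω (n + 1) le_rfl
    obtain ⟨z, hz⟩ := h.exists_int_walk n ω
    rw [hz] at ih
    rw [walk_succ X hn, hz] at hneA hneB ⊢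
    clear h0 hz
    obtain ⟨h1, h2⟩ := ih
    rcases h.val (n + 1) (by lia) ω with hx | hx | hx <;> rw [hx] at hneA hneB ⊢ <;>
      constructor <;> norm_cast at * <;> lia

lemma step_eq_one_of_exitAt (h : IsExampleChain μ X) {A B : ℕ} (hA : 0 < A) (hB : 0 < B) {n : ℕ}
    (hn : 1 ≤ n) {ω : Ω} (hω : ω ∈ exitAt X A B A n) : X (n + 1) ω = 1 := by
  have h1 := (h.walk_mem_Ioo hA hB hω.1).2
  have h2 : walk X (n + 1) ω = A := hω.2
  rw [walk_succ X hn] at h2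
  rcases h.val (n + 1) (by lia) ω with hx | hx | hx
  · exact hx
  all_goals rw [hx] at h2; linarith

lemma step_eq_neg_one_of_exitAt (h : IsExampleChain μ X) {A B : ℕ} (hA : 0 < A) (hB : 0 < B)
    {n : ℕ} (hn : 1 ≤ n) {ω : Ω} (hω : ω ∈ exitAt X A B (-B) n) : X (n + 1) ω = -1 := by
  have h1 := (h.walk_mem_Ioo hA hB hω.1).1
  have h2 : walk X (n + 1) ω = -B := hω.2
  rw [walk_succ X hn] at h2
  rcases h.val (n + 1) (by lia) ω with hx | hx | hx
  · rw [hx] at h2; linarith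
  · rw [hx] at h2; linarith
  · exact hx

variable [IsProbabilityMeasure μ]

lemma integrable_exampleKernel (h : IsExampleChain μ X) {n : ℕ} (hn : 2 ≤ n) (j : ℝ) :
    Integrable (fun ω => exampleKernel (X n ω) j) μ := by
  refine Integrable.of_bound
    ((measurable_exampleKernel j).comp (h.meas n hn)).aestronglyMeasurable 1 (.of_forall fun ω => ?_)
  rw [Real.norm_of_nonneg (exampleKernel_nonneg _ _)]
  exact exampleKernel_le_one _ _

/-- The Markov property as a statement on conditional expectations. -/
lemma condExp_step (h : IsExampleChain μ X) {n : ℕ} (hn : 2 ≤ n) {j : ℝ}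
    (hj : j ∈ ({1, 0, -1} : Set ℝ)) :
    (fun ω => exampleKernel (X n ω) j)
      =ᵐ[μ] μ[{ω | X (n + 1) ω = j}.indicator fun _ => (1 : ℝ) | sigmaFrom2 X n] := by
  have hJ : MeasurableSet {ω | X (n + 1) ω = j} :=
    h.meas (n + 1) (by lia) (measurableSet_singleton j)
  have hφint := h.integrable_exampleKernel hn j
  have hlevel : ∀ i, MeasurableSet {ω | X n ω = i} := fun i =>
    h.meas n hn (measurableSet_singleton i)
  refine ae_eq_condExp_of_forall_setIntegral_eq (h.sigmaFrom2_le n)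
    ((integrable_const (1 : ℝ)).indicator hJ) (fun _ _ _ => hφint.integrableOn) ?_ ?_
  · intro E hE _
    have hE' := h.sigmaFrom2_le n _ hE
    have hsplit : ∀ f : Ω → ℝ, Integrable f μ → ∫ ω in E, f ω ∂μ
        = ∫ ω in E ∩ {ω | X n ω = 1}, f ω ∂μ + ∫ ω in E ∩ {ω | X n ω = 0}, f ω ∂μ
          + ∫ ω in E ∩ {ω | X n ω = -1}, f ω ∂μ := by
      intro f hf
      have hcover : E = (E ∩ {ω | X n ω = 1} ∪ E ∩ {ω | X n ω = 0}) ∪ E ∩ {ω | X n ω = -1} := by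
        ext ω
        have := h.val n hn ω
        simp only [mem_union, mem_inter_iff, mem_ofPred_eq]
        tauto
      conv_lhs => rw [hcover]
      rw [setIntegral_union _ (hE'.inter (hlevel _)) hf.integrableOn hf.integrableOn,
        setIntegral_union _ (hE'.inter (hlevel _)) hf.integrableOn hf.integrableOn]
      · rw [Set.disjoint_left]
        rintro ω ⟨-, h1⟩ ⟨-, h2⟩
        simp only [mem_ofPred_eq] at h1 h2
        linarith
      · rw [Set.disjoint_left]
        rintro ω (⟨-, h1⟩ | ⟨-, h1⟩) ⟨-, h2⟩ <;>
        · simp only [mem_ofPred_eq] at h1 h2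
          linarith
    have hone : ∀ i ∈ ({1, 0, -1} : Set ℝ),
        ∫ ω in E ∩ {ω | X n ω = i}, exampleKernel (X n ω) j ∂μ
          = ∫ ω in E ∩ {ω | X n ω = i}, {ω | X (n + 1) ω = j}.indicator (fun _ => (1 : ℝ)) ω ∂μ := by
      intro i hi
      have hm := congrArg ENNReal.toReal (h.markov n hn i hi j hj E hE)
      rw [ENNReal.toReal_mul, ENNReal.toReal_ofReal (exampleKernel_nonneg i j)] at hm
      rw [setIntegral_congr_fun (g := fun _ => exampleKernel i j) (hE'.inter (hlevel i))
        (fun ω hω => by simp only [show X n ω = i from hω.2]),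
        setIntegral_const, setIntegral_indicator hJ, setIntegral_const, smul_eq_mul, smul_eq_mul,
        mul_one, mul_comm, measureReal_def, measureReal_def, ← hm, inter_assoc]
      rfl
    rw [hsplit _ hφint, hsplit _ ((integrable_const (1 : ℝ)).indicator hJ),
      hone 1 (by simp), hone 0 (by simp), hone (-1) (by simp)]
  · exact ((measurable_exampleKernel j).comp
      (measurable_step_sigmaFrom2 X hn le_rfl)).stronglyMeasurable.aestronglyMeasurable

lemma integral_mul_step (h : IsExampleChain μ X) {n : ℕ} (hn : 2 ≤ n) {j : ℝ}
    (hj : j ∈ ({1, 0, -1} : Set ℝ)) {f : Ω → ℝ} (hf : Measurable[sigmaFrom2 X n] f)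
    (hfi : Integrable f μ) :
    ∫ ω, f ω * {ω | X (n + 1) ω = j}.indicator (fun _ => (1 : ℝ)) ω ∂μ
      = ∫ ω, f ω * exampleKernel (X n ω) j ∂μ := by
  have hJ : MeasurableSet {ω | X (n + 1) ω = j} :=
    h.meas (n + 1) (by lia) (measurableSet_singleton j)
  have hfJ : Integrable (f * {ω | X (n + 1) ω = j}.indicator fun _ => (1 : ℝ)) μ := by
    have : (f * {ω | X (n + 1) ω = j}.indicator fun _ => (1 : ℝ))
        = {ω | X (n + 1) ω = j}.indicator f := by
      ext ω
      by_cases hω : ω ∈ {ω | X (n + 1) ω = j} <;> simp [hω]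
    rw [this]
    exact hfi.indicator hJ
  have key := condExp_mul_of_stronglyMeasurable_left hf.stronglyMeasurable hfJ
    ((integrable_const (1 : ℝ)).indicator hJ)
  calc ∫ ω, f ω * {ω | X (n + 1) ω = j}.indicator (fun _ => (1 : ℝ)) ω ∂μ
      = ∫ ω, μ[f * {ω | X (n + 1) ω = j}.indicator fun _ => (1 : ℝ) | sigmaFrom2 X n] ω ∂μ :=
        (integral_condExp (h.sigmaFrom2_le n)).symm
    _ = ∫ ω, f ω * exampleKernel (X n ω) j ∂μ := by
        refine integral_congr_ae ?_
        filter_upwards [key, h.condExp_step hn hj] with ω h1 h2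
        rw [h1, Pi.mul_apply, ← h2]

omit [IsProbabilityMeasure μ] in
lemma exists_bound_on_survival (h : IsExampleChain μ X) {A B : ℕ} (hA : 0 < A) (hB : 0 < B)
    {g : ℝ → ℝ} (hg : Continuous g) :
    ∃ C, 0 ≤ C ∧ ∀ n, ∀ ω ∈ survival X A B n, |g (walk X n ω)| ≤ C := by
  obtain ⟨C, hC⟩ := (isCompact_Icc (a := -(B : ℝ)) (b := A)).exists_bound_of_continuousOn
    hg.continuousOn
  refine ⟨|C|, abs_nonneg C, fun n ω hω => ?_⟩
  exact (hC _ (Ioo_subset_Icc_self (h.walk_mem_Ioo hA hB hω))).trans (le_abs_self C)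

lemma integrableOn_comp_walk (h : IsExampleChain μ X) {A B : ℕ} (hA : 0 < A) (hB : 0 < B)
    {g : ℝ → ℝ} (hg : Continuous g) (n : ℕ) :
    IntegrableOn (fun ω => g (walk X n ω)) (survival X A B n) μ := by
  obtain ⟨C, -, hC⟩ := h.exists_bound_on_survival hA hB hg
  refine Measure.integrableOn_of_bounded (M := C) (measure_ne_top _ _)
    (hg.measurable.comp (h.measurable_walk n)).aestronglyMeasurable ?_
  exact (ae_restrict_iff' (h.measurableSet_survival A B n)).2 (.of_forall fun ω hω => hC n ω hω)

omit [IsProbabilityMeasure μ] in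
lemma exists_bound_pair (h : IsExampleChain μ X) {A B : ℕ} (hA : 0 < A) (hB : 0 < B)
    {φ : ℝ → ℝ → ℝ} (hφ : ∀ j, Continuous (φ · j)) :
    ∃ C, 0 ≤ C ∧ ∀ n, 2 ≤ n → ∀ ω ∈ survival X A B n, |φ (walk X n ω) (X n ω)| ≤ C := by
  obtain ⟨C₁, h₁, hC₁⟩ := h.exists_bound_on_survival hA hB (hφ 1)
  obtain ⟨C₂, h₂, hC₂⟩ := h.exists_bound_on_survival hA hB (hφ 0)
  obtain ⟨C₃, h₃, hC₃⟩ := h.exists_bound_on_survival hA hB (hφ (-1))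
  refine ⟨C₁ + C₂ + C₃, by positivity, fun n hn ω hω => ?_⟩
  rcases h.val n hn ω with hx | hx | hx <;> rw [hx]
  · linarith [hC₁ n ω hω]
  · linarith [hC₂ n ω hω]
  · linarith [hC₃ n ω hω]

lemma integral_survival_step (h : IsExampleChain μ X) {A B : ℕ} (hA : 0 < A) (hB : 0 < B)
    {φ : ℝ → ℝ → ℝ} (hφ : ∀ j, Continuous (φ · j)) {n : ℕ} (hn : 2 ≤ n) :
    IntegrableOn (fun ω => φ (walk X (n + 1) ω) (X (n + 1) ω)) (survival X A B n) μ ∧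
    IntegrableOn (fun ω => ∑ j ∈ {1, 0, -1}, exampleKernel (X n ω) j * φ (walk X n ω + j) j)
      (survival X A B n) μ ∧
    ∫ ω in survival X A B n, φ (walk X (n + 1) ω) (X (n + 1) ω) ∂μ
      = ∫ ω in survival X A B n,
          ∑ j ∈ {1, 0, -1}, exampleKernel (X n ω) j * φ (walk X n ω + j) j ∂μ := by
  have hFm := measurableSet_survival_sigmaFrom2 X A B n
  have hF := h.measurableSet_survival A B n
  set F := survival X A B n
  have hshift : ∀ j, Continuous fun s => φ (s + j) j := fun j =>
    (hφ j).comp (continuous_id.add continuous_const)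
  have hfi : ∀ j, Integrable (F.indicator fun ω => φ (walk X n ω + j) j) μ := fun j =>
    (integrable_indicator_iff hF).2 (h.integrableOn_comp_walk hA hB (hshift j) n)
  have hfm : ∀ j, Measurable[sigmaFrom2 X n] (F.indicator fun ω => φ (walk X n ω + j) j) :=
    fun j => ((hshift j).measurable.comp (measurable_walk_sigmaFrom2 X le_rfl)).indicator hFm
  have hpt : F.indicator (fun ω => φ (walk X (n + 1) ω) (X (n + 1) ω)) = fun ω =>
      ∑ j ∈ {1, 0, -1}, F.indicator (fun ω => φ (walk X n ω + j) j) ω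
        * {ω | X (n + 1) ω = j}.indicator (fun _ => (1 : ℝ)) ω := by
    ext ω
    by_cases hω : ω ∈ F
    · rw [Finset.sum_insert (by norm_num), Finset.sum_insert (by norm_num), Finset.sum_singleton]
      simp only [indicator_of_mem hω, walk_succ X (by lia : 1 ≤ n)]
      rcases h.val (n + 1) (by lia) ω with hx | hx | hx <;>
        simp only [indicator, mem_ofPred_eq, hx] <;> norm_num
    · simp [hω]
  have hpt' : F.indicator
      (fun ω => ∑ j ∈ {1, 0, -1}, exampleKernel (X n ω) j * φ (walk X n ω + j) j) = fun ω =>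
      ∑ j ∈ {1, 0, -1}, F.indicator (fun ω => φ (walk X n ω + j) j) ω
        * exampleKernel (X n ω) j := by
    ext ω
    by_cases hω : ω ∈ F <;> simp [hω, mul_comm]
  have hi : ∀ j, Integrable (fun ω => F.indicator (fun ω => φ (walk X n ω + j) j) ω
      * {ω | X (n + 1) ω = j}.indicator (fun _ => (1 : ℝ)) ω) μ := by
    intro j
    refine (hfi j).mul_bdd (c := 1) ((measurable_const.indicator
      (h.meas (n + 1) (by lia) (measurableSet_singleton j))).aestronglyMeasurable)
      (.of_forall fun ω => ?_)
    by_cases hω : ω ∈ {ω | X (n + 1) ω = j} <;> simp [hω]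
  have hi' : ∀ j, Integrable (fun ω => F.indicator (fun ω => φ (walk X n ω + j) j) ω
      * exampleKernel (X n ω) j) μ := by
    intro j
    refine (hfi j).mul_bdd (c := 1) (h.integrable_exampleKernel hn j).aestronglyMeasurable
      (.of_forall fun ω => ?_)
    rw [Real.norm_of_nonneg (exampleKernel_nonneg _ _)]
    exact exampleKernel_le_one _ _
  refine ⟨?_, ?_, ?_⟩
  · rw [← integrable_indicator_iff hF, hpt]
    exact integrable_finsetSum _ fun j _ => hi j
  · rw [← integrable_indicator_iff hF, hpt']
    exact integrable_finsetSum _ fun j _ => hi' j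
  · rw [← integral_indicator hF, ← integral_indicator hF, hpt, hpt',
      integral_finsetSum _ fun j _ => hi j, integral_finsetSum _ fun j _ => hi' j]
    exact Finset.sum_congr rfl fun j hj => h.integral_mul_step hn (by simpa using hj) (hfm j) (hfi j)

omit [MeasurableSpace Ω] in
lemma survival_eq_union (X : ℕ → Ω → ℝ) (A B n : ℕ) :
    survival X A B n = (survival X A B (n + 1) ∪ exitAt X A B A n) ∪ exitAt X A B (-B) n := by
  ext ω
  simp only [survival, exitAt, mem_union, mem_inter_iff, mem_ofPred_eq]
  constructor
  · intro hω
    by_cases h1 : walk X (n + 1) ω = A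
    · exact .inl (.inr ⟨hω, h1⟩)
    by_cases h2 : walk X (n + 1) ω = -B
    · exact .inr ⟨hω, h2⟩
    refine .inl (.inl fun k hk => ?_)
    rcases Nat.le_succ_iff.1 hk with hk | rfl
    · exact hω k hk
    · exact ⟨h1, h2⟩
  · rintro ((hω | hω) | hω)
    · exact fun k hk => hω k (hk.trans n.le_succ)
    · exact hω.1
    · exact hω.1

/-- One-step balance for a function `φ` of the walk and its last step which the transition
operator maps to `φ + c`. -/
lemma balance_step (h : IsExampleChain μ X) {A B : ℕ} (hA : 0 < A) (hB : 0 < B)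
    {φ : ℝ → ℝ → ℝ} (hφ : ∀ j, Continuous (φ · j)) {c : ℝ}
    (hc : ∀ s, ∀ i ∈ ({1, 0, -1} : Set ℝ),
      ∑ j ∈ {1, 0, -1}, exampleKernel i j * φ (s + j) j = φ s i + c)
    {n : ℕ} (hn : 2 ≤ n) :
    ∫ ω in survival X A B n, φ (walk X n ω) (X n ω) ∂μ + c * μ.real (survival X A B n)
      = ∫ ω in survival X A B (n + 1), φ (walk X (n + 1) ω) (X (n + 1) ω) ∂μ
        + φ A 1 * μ.real (exitAt X A B A n) + φ (-B) (-1) * μ.real (exitAt X A B (-B) n) := by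
  obtain ⟨hφint, hφint₂, heq⟩ := h.integral_survival_step (μ := μ) hA hB hφ hn
  have hF := h.measurableSet_survival A B n
  have hpt : ∀ ω, ∑ j ∈ {1, 0, -1}, exampleKernel (X n ω) j * φ (walk X n ω + j) j
      = φ (walk X n ω) (X n ω) + c := fun ω => hc _ _ (by simpa using h.val n hn ω)
  simp only [hpt] at hφint₂ heq
  have hφint₃ : IntegrableOn (fun ω => φ (walk X n ω) (X n ω)) (survival X A B n) μ := by
    refine (hφint₂.sub (integrable_const c)).congr (.of_forall fun ω => ?_)
    simp
  rw [integral_add hφint₃ (integrable_const c), setIntegral_const, smul_eq_mul] at heq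
  rw [mul_comm c, ← heq]
  have hEA := h.measurableSet_exitAt A B A n
  have hEB := h.measurableSet_exitAt A B (-B) n
  have hu := survival_eq_union X A B n
  have hsub1 : survival X A B (n + 1) ⊆ survival X A B n := by rw [hu]; intro ω; simp; tauto
  have hsub2 : exitAt X A B A n ⊆ survival X A B n := inter_subset_left
  have hsub3 : exitAt X A B (-B) n ⊆ survival X A B n := inter_subset_left
  have e1 : ∫ ω in exitAt X A B A n, φ (walk X (n + 1) ω) (X (n + 1) ω) ∂μ
      = φ A 1 * μ.real (exitAt X A B A n) := by
    rw [setIntegral_congr_fun (g := fun _ => φ A 1) hEA, setIntegral_const, smul_eq_mul, mul_comm]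
    intro ω hω
    simp only [h.step_eq_one_of_exitAt hA hB (by lia) hω, show walk X (n + 1) ω = A from hω.2]
  have e2 : ∫ ω in exitAt X A B (-B) n, φ (walk X (n + 1) ω) (X (n + 1) ω) ∂μ
      = φ (-B) (-1) * μ.real (exitAt X A B (-B) n) := by
    rw [setIntegral_congr_fun (g := fun _ => φ (-B) (-1)) hEB, setIntegral_const, smul_eq_mul,
      mul_comm]
    intro ω hω
    simp only [h.step_eq_neg_one_of_exitAt hA hB (by lia) hω,
      show walk X (n + 1) ω = -B from hω.2]
  rw [← e1, ← e2]
  conv_lhs => rw [hu]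
  rw [setIntegral_union _ hEB ((hφint.mono_set hsub1).union (hφint.mono_set hsub2))
      (hφint.mono_set hsub3),
    setIntegral_union _ hEA (hφint.mono_set hsub1) (hφint.mono_set hsub2)]
  · rw [Set.disjoint_left]
    exact fun ω h1 h2 => (h1 (n + 1) le_rfl).1 h2.2
  · rw [Set.disjoint_left]
    rintro ω (h1 | h1) h2
    · exact (h1 (n + 1) le_rfl).2 h2.2
    · have e : (A : ℝ) = -B := h1.2.symm.trans h2.2
      have : (0 : ℝ) < A := by exact_mod_cast hA
      have : (0 : ℝ) < B := by exact_mod_cast hB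
      linarith

/-- Summed balance from time `2` on, for a chain started at state `0`. -/
lemma balance (h : IsExampleChain μ X) (hinit : ∀ᵐ ω ∂μ, X 2 ω = 0)
    {A B : ℕ} (hA : 0 < A) (hB : 0 < B)
    {φ : ℝ → ℝ → ℝ} (hφ : ∀ j, Continuous (φ · j)) {c : ℝ}
    (hc : ∀ s, ∀ i ∈ ({1, 0, -1} : Set ℝ),
      ∑ j ∈ {1, 0, -1}, exampleKernel i j * φ (s + j) j = φ s i + c) (N : ℕ) :
    φ 0 0 + c * ∑ m ∈ Finset.range N, μ.real (survival X A B (m + 2))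
      = ∫ ω in survival X A B (N + 2), φ (walk X (N + 2) ω) (X (N + 2) ω) ∂μ
        + φ A 1 * ∑ m ∈ Finset.range N, μ.real (exitAt X A B A (m + 2))
        + φ (-B) (-1) * ∑ m ∈ Finset.range N, μ.real (exitAt X A B (-B) (m + 2)) := by
  induction N with
  | zero =>
    have hA' : (A : ℝ) ≠ 0 := by positivity
    have hB' : (B : ℝ) ≠ 0 := by positivity
    have hF : survival X A B 2 =ᵐ[μ] univ := by
      rw [Filter.eventuallyEq_univ]
      filter_upwards [hinit] with ω hω k hk
      have : walk X k ω = 0 := by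
        rcases Nat.le_succ_iff.1 hk with hk | rfl
        · exact walk_of_le_one X hk ω
        · rw [walk_two, hω]
      rw [this]
      exact ⟨hA'.symm, (neg_ne_zero.2 hB').symm⟩
    have hval : ∫ ω, φ (walk X 2 ω) (X 2 ω) ∂μ = φ 0 0 := by
      rw [integral_congr_ae (g := fun _ => φ 0 0)]
      · simp
      · filter_upwards [hinit] with ω hω
        rw [walk_two, hω]
    simp [setIntegral_congr_set hF, hval]
  | succ N ih =>
    have hstep := h.balance_step (μ := μ) hA hB hφ hc (n := N + 2) (by lia)
    simp only [Finset.sum_range_succ, show N + 1 + 2 = N + 2 + 1 by ring]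
    linarith

omit [MeasurableSpace Ω] in
lemma disjoint_exitAt {A B : ℕ} {c : ℝ} (hc : c = A ∨ c = -B) :
    Pairwise (Function.onFun Disjoint fun m => exitAt X A B c (m + 2)) := by
  have key : ∀ m k, m < k → Disjoint (exitAt X A B c (m + 2)) (exitAt X A B c (k + 2)) := by
    intro m k hmk
    rw [Set.disjoint_left]
    rintro ω ⟨-, h1⟩ ⟨h2, -⟩
    have h3 := h2 (m + 2 + 1) (by lia)
    rw [show walk X (m + 2 + 1) ω = c from h1] at h3
    tauto
  intro m k hmk
  rcases lt_or_gt_of_ne hmk with hlt | hlt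
  · exact key m k hlt
  · exact (key k m hlt).symm

lemma hasSum_exitAt (h : IsExampleChain μ X) {A B : ℕ} {c : ℝ} (hc : c = A ∨ c = -B) :
    HasSum (fun m => μ.real (exitAt X A B c (m + 2))) (μ.real (⋃ m, exitAt X A B c (m + 2))) := by
  have hU := measure_iUnion (μ := μ) (disjoint_exitAt (X := X) hc)
    fun m => h.measurableSet_exitAt A B c (m + 2)
  have hne : ∑' m, μ (exitAt X A B c (m + 2)) ≠ ⊤ := hU ▸ measure_ne_top μ _
  rw [measureReal_def, hU, ENNReal.tsum_toReal_eq fun m => measure_ne_top μ _]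
  exact ENNReal.hasSum_toReal hne

lemma abs_setIntegral_le (h : IsExampleChain μ X) {A B : ℕ} (hA : 0 < A) (hB : 0 < B)
    {φ : ℝ → ℝ → ℝ} (hφ : ∀ j, Continuous (φ · j)) :
    ∃ C, ∀ n, 2 ≤ n → |∫ ω in survival X A B n, φ (walk X n ω) (X n ω) ∂μ|
      ≤ C * μ.real (survival X A B n) := by
  obtain ⟨C, -, hC⟩ := h.exists_bound_pair hA hB hφ
  refine ⟨C, fun n hn => ?_⟩
  rw [← Real.norm_eq_abs]
  exact MeasureTheory.norm_setIntegral_le_of_norm_le_const (measure_lt_top _ _) (hC n hn)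

/-- The drift of the walk forces it to leave every bounded interval. -/
lemma tendsto_survival (h : IsExampleChain μ X) (hinit : ∀ᵐ ω ∂μ, X 2 ω = 0)
    {A B : ℕ} (hA : 0 < A) (hB : 0 < B) :
    Filter.Tendsto (fun m => μ.real (survival X A B (m + 2))) Filter.atTop (nhds 0) := by
  let φ : ℝ → ℝ → ℝ := fun s x => s + if x = 1 then 19 / 45 else if x = 0 then 0 else -11 / 9
  have hφ : ∀ j, Continuous (φ · j) := fun j => continuous_id.add continuous_const
  have hc : ∀ s, ∀ i ∈ ({1, 0, -1} : Set ℝ),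
      ∑ j ∈ {1, 0, -1}, exampleKernel i j * φ (s + j) j = φ s i + (-4 / 15) := by
    intro s i hi
    rw [Finset.sum_insert (by norm_num), Finset.sum_insert (by norm_num), Finset.sum_singleton]
    rcases hi with rfl | rfl | rfl <;> norm_num [φ, exampleKernel] <;> ring
  have hbal := h.balance hinit hA hB hφ hc
  obtain ⟨C, hC⟩ := h.abs_setIntegral_le (μ := μ) hA hB hφ
  have hsA := h.hasSum_exitAt (A := A) (B := B) (.inl rfl)
  have hsB := h.hasSum_exitAt (A := A) (B := B) (.inr rfl)
  refine (summable_of_sum_range_le (c := 15 / 4 * (|C| + |φ A 1| + |φ (-B) (-1)| + |φ 0 0|))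
    (fun _ => measureReal_nonneg) fun N => ?_).tendsto_atTop_zero
  have b1 : |∫ ω in survival X A B (N + 2), φ (walk X (N + 2) ω) (X (N + 2) ω) ∂μ| ≤ |C| := by
    refine (hC _ (by lia)).trans ((mul_le_mul_of_nonneg_right (le_abs_self C)
      measureReal_nonneg).trans ?_)
    exact mul_le_of_le_one_right (abs_nonneg C) measureReal_le_one
  have b2 : ∀ (a : ℝ) {u : ℕ → ℝ} {U : ℝ}, HasSum u U → (∀ m, 0 ≤ u m) → U ≤ 1 →
      |a * ∑ m ∈ Finset.range N, u m| ≤ |a| := by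
    intro a u U hu h0 h1
    rw [abs_mul, abs_of_nonneg (Finset.sum_nonneg fun m _ => h0 m)]
    exact mul_le_of_le_one_right (abs_nonneg a)
      ((sum_le_hasSum _ (fun m _ => h0 m) hu).trans h1)
  have bA := b2 (φ A 1) hsA (fun _ => measureReal_nonneg) measureReal_le_one
  have bB := b2 (φ (-B) (-1)) hsB (fun _ => measureReal_nonneg) measureReal_le_one
  have := hbal N
  linarith [neg_le_of_abs_le b1, neg_le_of_abs_le bA, neg_le_of_abs_le bB, le_abs_self (φ 0 0)]

/-- The limit of the balance identity for a harmonic function. -/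
lemma harmonic_exit (h : IsExampleChain μ X) (hinit : ∀ᵐ ω ∂μ, X 2 ω = 0)
    {A B : ℕ} (hA : 0 < A) (hB : 0 < B)
    {φ : ℝ → ℝ → ℝ} (hφ : ∀ j, Continuous (φ · j))
    (hharm : ∀ s, ∀ i ∈ ({1, 0, -1} : Set ℝ),
      ∑ j ∈ {1, 0, -1}, exampleKernel i j * φ (s + j) j = φ s i) :
    φ 0 0 = φ A 1 * μ.real (⋃ m, exitAt X A B A (m + 2))
      + φ (-B) (-1) * μ.real (⋃ m, exitAt X A B (-B) (m + 2)) := by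
  have hbal := h.balance hinit hA hB hφ (c := 0) (by simpa using hharm)
  obtain ⟨C, hC⟩ := h.abs_setIntegral_le (μ := μ) hA hB hφ
  have hlim : Filter.Tendsto (fun N => ∫ ω in survival X A B (N + 2),
      φ (walk X (N + 2) ω) (X (N + 2) ω) ∂μ) Filter.atTop (nhds 0) := by
    refine squeeze_zero_norm (fun N => hC (N + 2) (by lia)) ?_
    simpa using (h.tendsto_survival hinit hA hB).const_mul C
  have hsA := (h.hasSum_exitAt (A := A) (B := B) (.inl rfl)).tendsto_sum_nat
  have hsB := (h.hasSum_exitAt (A := A) (B := B) (.inr rfl)).tendsto_sum_nat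
  have htot := (hlim.add (hsA.const_mul (φ A 1))).add (hsB.const_mul (φ (-B) (-1)))
  simp only [zero_mul, add_zero] at hbal
  simp only [← hbal, zero_add] at htot
  exact tendsto_nhds_unique tendsto_const_nhds htot

/-- The exit probability through the upper level. -/
lemma measureReal_exit_upper (h : IsExampleChain μ X) (hinit : ∀ᵐ ω ∂μ, X 2 ω = 0)
    {A B : ℕ} (hA : 0 < A) (hB : 0 < B) :
    μ.real (⋃ m, exitAt X A B A (m + 2))
      = ((18 / 13) * (13 / 10 : ℝ) ^ B - 1) / ((20 / 13) * (13 / 10 : ℝ) ^ (A + B) - 1) := by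
  have hone := h.harmonic_exit hinit hA hB (φ := fun _ _ => 1) (fun _ => continuous_const) (by
    intro s i hi
    rw [Finset.sum_insert (by norm_num), Finset.sum_insert (by norm_num), Finset.sum_singleton]
    rcases hi with rfl | rfl | rfl <;> norm_num [exampleKernel])
  let g : ℝ → ℝ := fun x => if x = 1 then 10 else if x = 0 then 9 else 13 / 2
  have hexp := h.harmonic_exit hinit hA hB (φ := fun s x => (13 / 10 : ℝ) ^ s * g x)
    (fun j => (Real.continuous_const_rpow (by norm_num)).mul continuous_const) (by
    intro s i hi
    rw [Finset.sum_insert (by norm_num), Finset.sum_insert (by norm_num), Finset.sum_singleton]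
    simp only [Real.rpow_add (by norm_num : (0 : ℝ) < 13 / 10), Real.rpow_neg_one, Real.rpow_one,
      Real.rpow_zero]
    rcases hi with rfl | rfl | rfl <;> norm_num [g, exampleKernel] <;> ring)
  norm_num [g] at hexp
  have hpos : (1 : ℝ) ≤ (13 / 10 : ℝ) ^ (A + B) := one_le_pow₀ (by norm_num)
  have hB0 : (0 : ℝ) < (13 / 10 : ℝ) ^ B := by positivity
  rw [eq_div_iff (by linarith)]
  rw [pow_add]
  generalize (13 / 10 : ℝ) ^ A = a at *
  generalize (13 / 10 : ℝ) ^ B = b at *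
  generalize μ.real (⋃ m, exitAt X A B A (m + 2)) = α at *
  have hβ : μ.real (⋃ m, exitAt X A B (-B) (m + 2)) = 1 - α := by linarith
  rw [hβ] at hexp
  field_simp at hexp
  linarith

end IsExampleChain

omit [MeasurableSpace Ω] in
/-- On paths with `X 2 = 0`, stopping at level `A` is the same as leaving through `A`. -/
lemma walk_sInf_eq_iff {X : ℕ → Ω → ℝ} {A B : ℕ} (hA : 0 < A) {ω : Ω} (hω : X 2 ω = 0) :
    walk X (sInf {k | walk X k ω = (A : ℝ) ∨ walk X k ω = -(B : ℝ)}) ω = A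
      ↔ ω ∈ ⋃ m, exitAt X A B A (m + 2) := by
  have hA' : (A : ℝ) ≠ 0 := by positivity
  have hsmall : ∀ k ≤ 2, walk X k ω = 0 := by
    intro k hk
    rcases Nat.le_succ_iff.1 hk with hk | rfl
    · exact walk_of_le_one X hk ω
    · rw [walk_two, hω]
  rw [mem_iUnion]
  set T := {k | walk X k ω = (A : ℝ) ∨ walk X k ω = -(B : ℝ)} with hT
  constructor
  · intro hlevelA
    have h3 : 2 < sInf T := by
      by_contra! hle
      exact hA' (hlevelA.symm.trans (hsmall _ hle))
    refine ⟨sInf T - 3, fun k hk => ?_, ?_⟩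
    · have : k ∉ T := Nat.notMem_of_lt_sInf (by lia)
      simpa [hT] using this
    · rw [mem_ofPred_eq, show sInf T - 3 + 2 + 1 = sInf T by lia]
      exact hlevelA
  · rintro ⟨m, hm, hm'⟩
    have hmem : m + 2 + 1 ∈ T := .inl hm'
    have hle := Nat.sInf_le hmem
    have heq : sInf T = m + 2 + 1 := by
      by_contra hne
      have h1 := hm (sInf T) (by lia)
      rcases Nat.sInf_mem ⟨_, hmem⟩ with h2 | h2
      · exact h1.1 h2
      · exact h1.2 h2
    rw [heq]
    exact hm'

/-- For the example three-state Markov chain `{X_n}_{n ≥ 2}` on `{1, 0, -1}` with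
transition matrix rows `(1/2, 1/4, 1/4)`, `(1/3, 1/3, 1/3)`, `(1/8, 1/8, 3/4)` and
initial distribution `(0, 1, 0)` (concentrated at state `0`), with
`S_n = X_2 + ⋯ + X_n` and `τ = inf{k : S_k = A or S_k = -B}`, the ruin
probability is `α = P(S_τ = A) = ((18/13)·(13/10)^B - 1)/((20/13)·(13/10)^(A+B) - 1)`. -/
theorem example_chain_ruin_probability
    (μ : Measure Ω) [IsProbabilityMeasure μ] (X : ℕ → Ω → ℝ)
    (hXm : ∀ i, 2 ≤ i → Measurable (X i))
    (hval : ∀ n, 2 ≤ n → ∀ ω, X n ω = 1 ∨ X n ω = 0 ∨ X n ω = -1)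
    (hinit : μ {ω | X 2 ω = 0} = 1)
    (hMarkov : ∀ n, 2 ≤ n → ∀ i ∈ ({1, 0, -1} : Set ℝ), ∀ j ∈ ({1, 0, -1} : Set ℝ),
      ∀ E : Set Ω, MeasurableSet[sigmaFrom2 X n] E →
        μ (E ∩ {ω | X n ω = i ∧ X (n + 1) ω = j})
          = ENNReal.ofReal (exampleKernel i j) * μ (E ∩ {ω | X n ω = i}))
    (S : ℕ → Ω → ℝ) (hS : ∀ n ω, S n ω = ∑ i ∈ Finset.Icc 2 n, X i ω)
    (A B : ℕ) (hA : 0 < A) (hB : 0 < B)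
    (τ : Ω → ℕ)
    (hτ : ∀ ω, τ ω = sInf {k | S k ω = (A : ℝ) ∨ S k ω = -(B : ℝ)}) :
    (μ {ω | S (τ ω) ω = (A : ℝ)}).toReal
      = ((18 / 13) * (13 / 10 : ℝ) ^ B - 1)
        / ((20 / 13) * (13 / 10 : ℝ) ^ (A + B) - 1) := by
  have h : IsExampleChain μ X := ⟨hXm, hval, hMarkov⟩
  have hinit' : ∀ᵐ ω ∂μ, X 2 ω = 0 := by
    exact (mem_ae_iff_prob_eq_one (hXm 2 le_rfl (measurableSet_singleton 0))).2 hinit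
  obtain rfl : S = walk X := by
    funext n ω
    exact hS n ω
  rw [← h.measureReal_exit_upper hinit' hA hB, measureReal_def]
  congr 1
  refine measure_congr ?_
  filter_upwards [hinit'] with ω hω
  refine propext ?_
  change walk X (τ ω) ω = A ↔ ω ∈ ⋃ m, exitAt X A B A (m + 2)
  rw [← walk_sInf_eq_iff hA hω, ← hτ ω]
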